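/- Let P_X be a Borel distribution on 𝒳 ⊆ ℝ^d, X ∼ P_X, ξ ∼ N(0,σ²) independent of X, R > 0, and g_1, g_2 : 𝒳 → [−R, R] Borel measurable. Let P_1 and P_2 be the distributions of (X, g_1(X)+ξ) and (X, g_2(X)+ξ) respectively, and let Y_1 := g_1(X)+ξ. If KL(P_1, P_2) ≤ ε² and V_2(P_1, P_2) ≤ ε², then W := log (dP_2/dP_1)(X, Y_1) − E log (dP_2/dP_1)(X, Y_1) is sub-Gamma in both tails with variance parameter (8 ∨ 2/σ²) ε² and scale parameter c := (2R/σ) ∨ (4R²/(3σ²)). -/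

import Mathlib

open MeasureTheory ProbabilityTheory Real

noncomputable section

/-- The distribution of `(X, g(X) + ξ)` where `X ∼ P_X` and `ξ ∼ N(0, σ²)` independent of `X`. -/
def gaussRegMeasure {d : ℕ} (PX : Measure (Fin d → ℝ)) (σ : ℝ)
    (g : (Fin d → ℝ) → ℝ) : Measure ((Fin d → ℝ) × ℝ) :=
  (PX.prod (gaussianReal 0 (Real.toNNReal (σ ^ 2)))).map fun q => (q.1, g q.1 + q.2)

/-- A (zero-mean) random variable `W` on `(Ω, μ)` is sub-Gamma in the right tail with
variance parameter `v` and scale parameter `c` if `E e^{λW} ≤ exp(vλ²/(2(1−cλ)))`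
for all `λ ∈ [0, 1/c)`. -/
def SubGammaRight {Ω : Type*} [MeasurableSpace Ω] (μ : Measure Ω) (W : Ω → ℝ)
    (v c : ℝ) : Prop :=
  ∀ l : ℝ, 0 ≤ l → l < 1 / c →
    ∫ ω, Real.exp (l * W ω) ∂μ ≤ Real.exp (v * l ^ 2 / (2 * (1 - c * l)))

/-- `W` is sub-Gamma in the left tail if `−W` is sub-Gamma in the right tail. -/
def SubGammaLeft {Ω : Type*} [MeasurableSpace Ω] (μ : Measure Ω) (W : Ω → ℝ)
    (v c : ℝ) : Prop :=
  SubGammaRight μ (fun ω => -W ω) v c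

/-- `W` is sub-Gamma in both tails if it is sub-Gamma in the right and in the left tail. -/
def SubGammaBoth {Ω : Type*} [MeasurableSpace Ω] (μ : Measure Ω) (W : Ω → ℝ)
    (v c : ℝ) : Prop :=
  SubGammaRight μ W v c ∧ SubGammaLeft μ W v c


theorem aux_exp_le {u : ℝ} (hu : |u| ≤ 2) : Real.exp u ≤ 1 + u + 2 * u ^ 2 := by
  have h2 : |u / 2| ≤ 1 := by rw [abs_div]; norm_num; linarith
  have h := Real.abs_exp_sub_one_sub_id_le h2
  have h3 : Real.exp (u/2) ≤ 1 + u/2 + (u/2)^2 := by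
    have := (abs_le.mp h).2; linarith
  have h4 : Real.exp u = Real.exp (u/2) ^ 2 := by
    rw [← Real.exp_nat_mul]; congr 1; push_cast; ring
  have h5 : Real.exp (u/2) ^ 2 ≤ (1 + u/2 + (u/2)^2)^2 := by
    gcongr
  have hu2 := abs_le.mp hu
  rw [h4]
  refine h5.trans ?_
  have h6 : u ^ 2 ≤ 4 := by nlinarith
  nlinarith [mul_nonneg (sq_nonneg u) (by linarith : (0:ℝ) ≤ 2 - u),
    mul_nonneg (sq_nonneg u) (by linarith : (0:ℝ) ≤ 4 - u^2)]

theorem aux_bounded_int {α : Type*} [MeasurableSpace α] (P : Measure α) [IsProbabilityMeasure P]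
    (f : α → ℝ) (hf : Measurable f) (C : ℝ) (h : ∀ x, |f x| ≤ C) : Integrable f P :=
  Integrable.of_bound hf.aestronglyMeasurable C (Filter.Eventually.of_forall h)

theorem aux_mgf {α : Type*} [MeasurableSpace α] (P : Measure α) [IsProbabilityMeasure P]
    (T : α → ℝ) (hT : Measurable T) (M : ℝ) (h0 : ∀ x, 0 ≤ T x) (hM : ∀ x, T x ≤ M)
    (m Vr : ℝ) (hm : m = ∫ x, T x ∂P) (hVr : Vr = ∫ x, (m - T x) ^ 2 ∂P)
    (l τ : ℝ) (hl : 0 ≤ l) (hτ : τ = 1 ∨ τ = -1) (h1 : l * M ≤ 3 / 2) (h2 : l ^ 2 * M ≤ 1 / 2) :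
    ∫ x, Real.exp (l * τ * (m - T x) + l ^ 2 * T x) ∂P ≤ Real.exp (l ^ 2 * (3 * m + 4 * Vr)) := by
  have iT : Integrable T P := aux_bounded_int P T hT M
    (fun x => by rw [abs_of_nonneg (h0 x)]; exact hM x)
  have hm0 : 0 ≤ m := by rw [hm]; exact integral_nonneg h0
  have hmM : m ≤ M := by
    rw [hm]
    calc ∫ x, T x ∂P ≤ ∫ x, M ∂P := integral_mono iT (integrable_const _) hM
      _ = M := by simp
  have habs : ∀ x, |m - T x| ≤ M := fun x => by
    rw [abs_le]; constructor <;> linarith [h0 x, hM x]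
  have iT2 : Integrable (fun x => (m - T x) ^ 2) P :=
    aux_bounded_int P _ (by fun_prop) (M ^ 2) (fun x => by
      rw [abs_pow]; gcongr; exact habs x)
  have hV0 : 0 ≤ Vr := by rw [hVr]; exact integral_nonneg fun x => sq_nonneg _
  have iA : Integrable (fun x => m - T x) P := (integrable_const m).sub iT
  have eA : ∫ x, (m - T x) ∂P = 0 := by
    rw [integral_sub (integrable_const _) iT, ← hm]; simp
  have hVM : Vr ≤ M * m := by
    have : Vr ≤ ∫ x, (m ^ 2 + (M - 2 * m) * T x) ∂P := by
      rw [hVr]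
      refine integral_mono iT2 ((integrable_const _).add (iT.const_mul _)) fun x => ?_
      simp only
      nlinarith [mul_nonneg (h0 x) (sub_nonneg.2 (hM x))]
    rw [integral_add (integrable_const _) (iT.const_mul _), integral_const_mul, ← hm] at this
    simp at this
    nlinarith [sq_nonneg m]
  set s : ℝ := l * τ - l ^ 2 with hs
  have hsabs : |s| ≤ l + l ^ 2 := by
    rw [abs_le]; rcases hτ with h | h <;> rw [hs, h] <;> constructor <;> nlinarith [sq_nonneg l]
  have hM0 : 0 ≤ M := hm0.trans hmM
  have hs2 : s ^ 2 ≤ 2 * l ^ 2 + 2 * l ^ 4 := by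
    have : s ^ 2 ≤ (l + l ^ 2) ^ 2 := by rw [← sq_abs]; gcongr
    nlinarith [sq_nonneg (l - l ^ 2)]
  have hpt : ∀ x, Real.exp (l * τ * (m - T x) + l ^ 2 * T x) ≤
      Real.exp (l ^ 2 * m) * (1 + s * (m - T x) + 2 * s ^ 2 * (m - T x) ^ 2) := fun x => by
    have e : l * τ * (m - T x) + l ^ 2 * T x = l ^ 2 * m + s * (m - T x) := by rw [hs]; ring
    rw [e, Real.exp_add]
    gcongr
    have := aux_exp_le (u := s * (m - T x)) (by
      rw [abs_mul]
      calc |s| * |m - T x| ≤ (l + l^2) * M := by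
            gcongr
            exact habs x
        _ ≤ 2 := by linarith)
    linarith
  have i1 : Integrable (fun x => 1 + s * (m - T x)) P := (integrable_const _).add (iA.const_mul _)
  have i2 : Integrable (fun x => 2 * s ^ 2 * (m - T x) ^ 2) P := iT2.const_mul _
  have key : ∫ x, Real.exp (l * τ * (m - T x) + l ^ 2 * T x) ∂P ≤
      ∫ x, Real.exp (l ^ 2 * m) * (1 + s * (m - T x) + 2 * s ^ 2 * (m - T x) ^ 2) ∂P :=
    integral_mono_of_nonneg (Filter.Eventually.of_forall fun x => (Real.exp_pos _).le)
      ((i1.add i2).const_mul _) (Filter.Eventually.of_forall hpt)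
  rw [integral_const_mul, integral_add i1 i2, integral_add (integrable_const _) (iA.const_mul _),
    integral_const_mul, integral_const_mul, eA, ← hVr] at key
  simp only [integral_const, probReal_univ, smul_eq_mul, mul_one, mul_zero, add_zero] at key
  refine key.trans ?_
  calc Real.exp (l ^ 2 * m) * (1 + 2 * s ^ 2 * Vr)
      ≤ Real.exp (l ^ 2 * m) * Real.exp (2 * s ^ 2 * Vr) := by
        gcongr; linarith [Real.add_one_le_exp (2 * s ^ 2 * Vr)]
    _ = Real.exp (l ^ 2 * m + 2 * s ^ 2 * Vr) := (Real.exp_add _ _).symm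
    _ ≤ _ := by
        apply Real.exp_le_exp.2
        have a1 : s ^ 2 * Vr ≤ (2 * l ^ 2 + 2 * l ^ 4) * Vr := by gcongr
        have a2 : l ^ 4 * Vr ≤ l ^ 4 * (M * m) := by gcongr
        have a3 : (l ^ 2 * M) * (l ^ 2 * m) ≤ 1 / 2 * (l ^ 2 * m) := by gcongr
        nlinarith

/-- log-likelihood ratio. -/
def gllr {d : ℕ} (σ : ℝ) (g₁ g₂ : (Fin d → ℝ) → ℝ) (z : (Fin d → ℝ) × ℝ) : ℝ :=
  ((z.2 - g₁ z.1) ^ 2 - (z.2 - g₂ z.1) ^ 2) / (2 * σ ^ 2)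

theorem llr_meas {d : ℕ} (σ : ℝ) (g₁ g₂ : (Fin d → ℝ) → ℝ) (hg₁ : Measurable g₁)
    (hg₂ : Measurable g₂) : Measurable (gllr σ g₁ g₂) := by
  unfold gllr; fun_prop

theorem gauss_density (σ : ℝ) (hσ : 0 < σ) (a b : ℝ) :
    gaussianReal b (Real.toNNReal (σ ^ 2)) = (gaussianReal a (Real.toNNReal (σ ^ 2))).withDensity
      fun y => ENNReal.ofReal (Real.exp (((y - a) ^ 2 - (y - b) ^ 2) / (2 * σ ^ 2))) := by
  have hv : Real.toNNReal (σ ^ 2) ≠ 0 := by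
    rw [Ne, Real.toNNReal_eq_zero, not_le]; positivity
  rw [gaussianReal_of_var_ne_zero _ hv, gaussianReal_of_var_ne_zero _ hv,
    ← withDensity_mul _ (measurable_gaussianPDF _ _) (by fun_prop)]
  congr 1
  ext y
  simp only [Pi.mul_apply, gaussianPDF]
  rw [← ENNReal.ofReal_mul (gaussianPDFReal_nonneg _ _ _)]
  congr 1
  simp only [gaussianPDFReal]
  rw [mul_assoc (√_)⁻¹, ← Real.exp_add, Real.coe_toNNReal _ (by positivity)]
  congr 2
  field_simp
  ring

theorem reg_lintegral {d : ℕ} (PX : Measure (Fin d → ℝ)) [IsProbabilityMeasure PX] (σ : ℝ)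
    (g : (Fin d → ℝ) → ℝ) (hg : Measurable g) (f : (Fin d → ℝ) × ℝ → ENNReal) (hf : Measurable f) :
    ∫⁻ z, f z ∂(gaussRegMeasure PX σ g) =
      ∫⁻ x, ∫⁻ y, f (x, y) ∂(gaussianReal (g x) (Real.toNNReal (σ ^ 2))) ∂PX := by
  unfold gaussRegMeasure
  rw [lintegral_map hf (by fun_prop), lintegral_prod _ (by fun_prop)]
  congr 1
  ext x
  have : gaussianReal (g x) (Real.toNNReal (σ ^ 2)) =
      (gaussianReal 0 (Real.toNNReal (σ ^ 2))).map (fun y => g x + y) := by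
    rw [gaussianReal_map_const_add]; simp
  rw [this, lintegral_map (by fun_prop) (by fun_prop)]

theorem reg_density {d : ℕ} (PX : Measure (Fin d → ℝ)) [IsProbabilityMeasure PX] (σ : ℝ)
    (hσ : 0 < σ) (g₁ g₂ : (Fin d → ℝ) → ℝ) (hg₁ : Measurable g₁) (hg₂ : Measurable g₂) :
    gaussRegMeasure PX σ g₂ = (gaussRegMeasure PX σ g₁).withDensity
      fun z => ENNReal.ofReal (Real.exp (gllr σ g₁ g₂ z)) := by
  have hl := llr_meas σ g₁ g₂ hg₁ hg₂
  refine Measure.ext_of_lintegral _ fun f hf => ?_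
  rw [lintegral_withDensity_eq_lintegral_mul _ (by fun_prop) hf, reg_lintegral _ _ _ hg₂ _ hf,
    reg_lintegral _ _ _ hg₁ _ (by fun_prop)]
  congr 1
  ext x
  rw [gauss_density σ hσ (g₁ x) (g₂ x), lintegral_withDensity_eq_lintegral_mul _ (by fun_prop)
    (by fun_prop)]
  rfl

instance reg_prob {d : ℕ} (PX : Measure (Fin d → ℝ)) [IsProbabilityMeasure PX] (σ : ℝ)
    (g : (Fin d → ℝ) → ℝ) [hg : Fact (Measurable g)] :
    IsProbabilityMeasure (gaussRegMeasure PX σ g) := by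
  have := hg.out
  unfold gaussRegMeasure
  exact Measure.isProbabilityMeasure_map (by fun_prop)

theorem reg_log {d : ℕ} (PX : Measure (Fin d → ℝ)) [IsProbabilityMeasure PX] (σ : ℝ)
    (hσ : 0 < σ) (g₁ g₂ : (Fin d → ℝ) → ℝ) (hg₁ : Measurable g₁) (hg₂ : Measurable g₂) :
    (fun z => Real.log (((gaussRegMeasure PX σ g₂).rnDeriv (gaussRegMeasure PX σ g₁) z).toReal))
      =ᵐ[gaussRegMeasure PX σ g₁] gllr σ g₁ g₂ := by
  have hl := llr_meas σ g₁ g₂ hg₁ hg₂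
  haveI := Fact.mk hg₁
  have h := Measure.rnDeriv_withDensity (gaussRegMeasure PX σ g₁)
    (f := fun z => ENNReal.ofReal (Real.exp (gllr σ g₁ g₂ z))) (by fun_prop)
  rw [← reg_density PX σ hσ g₁ g₂ hg₁ hg₂] at h
  filter_upwards [h] with z hz
  rw [hz, ENNReal.toReal_ofReal (Real.exp_pos _).le, Real.log_exp]

theorem reg_ac {d : ℕ} (PX : Measure (Fin d → ℝ)) [IsProbabilityMeasure PX] (σ : ℝ)
    (hσ : 0 < σ) (g₁ g₂ : (Fin d → ℝ) → ℝ) (hg₁ : Measurable g₁) (hg₂ : Measurable g₂) :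
    gaussRegMeasure PX σ g₂ ≪ gaussRegMeasure PX σ g₁ := by
  rw [reg_density PX σ hσ g₁ g₂ hg₁ hg₂]
  exact withDensity_absolutelyContinuous _ _

theorem llr_shift {d : ℕ} (σ : ℝ) (hσ : 0 < σ) (g₁ g₂ : (Fin d → ℝ) → ℝ)
    (q : (Fin d → ℝ) × ℝ) : gllr σ g₁ g₂ (q.1, g₁ q.1 + q.2) =
      (-(g₁ q.1 - g₂ q.1) / σ ^ 2) * q.2 - (g₁ q.1 - g₂ q.1) ^ 2 / (2 * σ ^ 2) := by
  unfold gllr; field_simp; ring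

theorem aux_prod {α : Type*} [MeasurableSpace α] (P : Measure α) [IsProbabilityMeasure P]
    (σ : ℝ) (hσ : 0 < σ) (a T : α → ℝ) (ha : Measurable a) (hT : Measurable T) (M A : ℝ)
    (haT : ∀ x, a x ^ 2 * σ ^ 2 = 2 * T x) (hA : ∀ x, |a x| ≤ A)
    (h0 : ∀ x, 0 ≤ T x) (hM : ∀ x, T x ≤ M)
    (m Vr : ℝ) (hm : m = ∫ x, T x ∂P) (hVr : Vr = ∫ x, (m - T x) ^ 2 ∂P) :
    (∫ q, (a q.1 * q.2 - T q.1) ∂(P.prod (gaussianReal 0 (Real.toNNReal (σ ^ 2)))) = -m) ∧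
    (∫ q, (a q.1 * q.2 - T q.1 + m) ^ 2 ∂(P.prod (gaussianReal 0 (Real.toNNReal (σ ^ 2))))
      = 2 * m + Vr) ∧
    (∀ l τ : ℝ, 0 ≤ l → (τ = 1 ∨ τ = -1) → l * M ≤ 3 / 2 → l ^ 2 * M ≤ 1 / 2 →
      ∫ q, Real.exp (l * (τ * (a q.1 * q.2 - T q.1 + m)))
        ∂(P.prod (gaussianReal 0 (Real.toNNReal (σ ^ 2)))) ≤
        Real.exp (l ^ 2 * (3 * m + 4 * Vr))) := by
  have iT : Integrable T P := aux_bounded_int P T hT M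
    (fun x => by rw [abs_of_nonneg (h0 x)]; exact hM x)
  have hm0 : 0 ≤ m := by rw [hm]; exact integral_nonneg h0
  have hmM : m ≤ M := by
    rw [hm]
    calc ∫ x, T x ∂P ≤ ∫ x, M ∂P := integral_mono iT (integrable_const _) hM
      _ = M := by simp
  have habs : ∀ x, |m - T x| ≤ M := fun x => by
    rw [abs_le]; constructor <;> linarith [h0 x, hM x]
  have iT2 : Integrable (fun x => (m - T x) ^ 2) P :=
    aux_bounded_int P _ (by fun_prop) (M ^ 2) (fun x => by
      rw [abs_pow]; gcongr; exact habs x)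
  have ia : Integrable a P := aux_bounded_int P a ha A hA
  have ib : Integrable (fun x => 2 * (m - T x) * a x) P :=
    aux_bounded_int P _ (by fun_prop) (2 * M * A) (fun x => by
      rw [abs_mul, abs_mul, abs_two]
      have := (abs_nonneg _).trans (habs x)
      gcongr
      · exact habs x
      · exact hA x)
  have ia2 : Integrable (fun x => a x ^ 2) P := aux_bounded_int P _ (by fun_prop) (A^2)
    (fun x => by rw [abs_pow]; gcongr; exact hA x)
  set N := gaussianReal 0 (Real.toNNReal (σ ^ 2)) with hN
  have hid : MemLp id 2 N := memLp_id_gaussianReal 2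
  have iid : Integrable (fun y : ℝ => y) N := hid.integrable (by norm_num)
  have iid2 : Integrable (fun y : ℝ => y ^ 2) N := hid.integrable_sq
  have eid : ∫ y, y ∂N = 0 := integral_id_gaussianReal
  have eid2 : ∫ y, y ^ 2 ∂N = σ ^ 2 := by
    have h := variance_id_gaussianReal (μ := 0) (v := Real.toNNReal (σ ^ 2))
    rw [variance_eq_integral (by fun_prop)] at h
    simp only [id] at h
    rw [← hN, eid, Real.coe_toNNReal _ (by positivity)] at h
    simpa using h
  have iT' : Integrable (fun q : α × ℝ => T q.1) (P.prod N) := iT.comp_fst N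
  refine ⟨?_, ?_, ?_⟩
  · rw [integral_sub (ia.mul_prod iid) iT', integral_prod_mul a (fun y => y), eid,
      integral_fun_fst, ← hm]
    simp
  · have e : ∀ q : α × ℝ, (a q.1 * q.2 - T q.1 + m) ^ 2 =
      (a q.1 ^ 2 * q.2 ^ 2 + (2 * (m - T q.1) * a q.1) * q.2) + (m - T q.1) ^ 2 := fun q => by ring
    simp_rw [e]
    have j1 := ia2.mul_prod iid2
    have j2 := ib.mul_prod iid
    have j3 : Integrable (fun q : α × ℝ => (m - T q.1) ^ 2) (P.prod N) := iT2.comp_fst N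
    have j12 : Integrable (fun q : α × ℝ => a q.1 ^ 2 * q.2 ^ 2 + 2 * (m - T q.1) * a q.1 * q.2)
        (P.prod N) := j1.add j2
    rw [integral_add j12 j3, integral_add j1 j2,
      integral_prod_mul (fun x => a x ^ 2) (fun y => y ^ 2),
      integral_prod_mul (fun x => 2 * (m - T x) * a x) (fun y => y), eid, eid2,
      integral_fun_fst (fun x => (m - T x) ^ 2), ← hVr, ← integral_mul_const]
    simp_rw [haT]
    rw [integral_const_mul, ← hm]
    simp
  · intro l τ hl hτ h1 h2
    by_cases hi : Integrable (fun q : α × ℝ => Real.exp (l * (τ * (a q.1 * q.2 - T q.1 + m))))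
      (P.prod N)
    swap
    · rw [integral_undef hi]; positivity
    rw [integral_prod _ hi]
    refine le_trans (le_of_eq ?_) (aux_mgf P T hT M h0 hM m Vr hm hVr l τ hl hτ h1 h2)
    congr 1
    ext x
    have e : ∀ y : ℝ, Real.exp (l * (τ * (a x * y - T x + m))) =
        Real.exp (l * τ * (m - T x)) * Real.exp ((l * τ * a x) * y) := fun y => by
      rw [← Real.exp_add]; congr 1; ring
    simp_rw [e]
    rw [integral_const_mul, Real.exp_add]
    congr 1
    have := congrFun (mgf_id_gaussianReal (μ := 0) (v := Real.toNNReal (σ ^ 2))) (l * τ * a x)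
    simp only [mgf, id] at this
    rw [hN, this, Real.coe_toNNReal _ (by positivity)]
    congr 1
    have ht : τ ^ 2 = 1 := by rcases hτ with h | h <;> rw [h] <;> norm_num
    linear_combination (l ^ 2 * τ ^ 2 / 2) * haT x + l ^ 2 * T x * ht

/-- Lemma: the centred log-likelihood ratio in Gaussian nonparametric
regression is sub-Gamma in both tails. -/
theorem gaussian_regression_subGamma
    {d : ℕ} (PX : Measure (Fin d → ℝ)) [IsProbabilityMeasure PX]
    (σ : ℝ) (hσ : 0 < σ) (R : ℝ) (hR : 0 < R)
    (g₁ g₂ : (Fin d → ℝ) → ℝ) (hg₁ : Measurable g₁) (hg₂ : Measurable g₂)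
    (hb₁ : ∀ x, g₁ x ∈ Set.Icc (-R) R) (hb₂ : ∀ x, g₂ x ∈ Set.Icc (-R) R)
    (P₁ P₂ : Measure ((Fin d → ℝ) × ℝ))
    (hP₁ : P₁ = gaussRegMeasure PX σ g₁) (hP₂ : P₂ = gaussRegMeasure PX σ g₂)
    (ε : ℝ) (hε : 0 < ε)
    -- KL(P₁, P₂) ≤ ε²
    (hKL : ∫ z, Real.log ((P₁.rnDeriv P₂ z).toReal) ∂P₁ ≤ ε ^ 2)
    -- V₂(P₁, P₂) ≤ ε²
    (hV2 : variance (fun z => Real.log ((P₁.rnDeriv P₂ z).toReal)) P₁ ≤ ε ^ 2) :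
    SubGammaBoth P₁
      (fun z => Real.log ((P₂.rnDeriv P₁ z).toReal)
        - ∫ z', Real.log ((P₂.rnDeriv P₁ z').toReal) ∂P₁)
      (max 8 (2 / σ ^ 2) * ε ^ 2)
      (max (2 * R / σ) (4 * R ^ 2 / (3 * σ ^ 2))) := by
  have iP1 : IsProbabilityMeasure P₁ := by
    haveI := Fact.mk hg₁
    rw [hP₁]; infer_instance
  have hl := llr_meas σ g₁ g₂ hg₁ hg₂
  have L21 : (fun z => Real.log ((P₂.rnDeriv P₁ z).toReal)) =ᵐ[P₁] gllr σ g₁ g₂ := by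
    rw [hP₁, hP₂]; exact reg_log PX σ hσ g₁ g₂ hg₁ hg₂
  have L12 : (fun z => Real.log ((P₁.rnDeriv P₂ z).toReal)) =ᵐ[P₁] fun z => -gllr σ g₁ g₂ z := by
    have h := reg_log PX σ hσ g₂ g₁ hg₂ hg₁
    rw [← hP₁, ← hP₂] at h
    have hac : P₁ ≪ P₂ := by rw [hP₁, hP₂]; exact reg_ac PX σ hσ g₂ g₁ hg₂ hg₁
    filter_upwards [hac.ae_le h] with z hz
    rw [hz]; unfold gllr; ring
  let T : (Fin d → ℝ) → ℝ := fun x => (g₁ x - g₂ x) ^ 2 / (2 * σ ^ 2)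
  let a : (Fin d → ℝ) → ℝ := fun x => -(g₁ x - g₂ x) / σ ^ 2
  have hTm : Measurable T := by fun_prop
  have ham : Measurable a := by fun_prop
  have hD : ∀ x, |g₁ x - g₂ x| ≤ 2 * R := fun x => by
    obtain ⟨p, q⟩ := hb₁ x
    obtain ⟨r, s⟩ := hb₂ x
    rw [abs_le]; constructor <;> linarith
  let M : ℝ := 2 * R ^ 2 / σ ^ 2
  obtain ⟨m, hm⟩ : ∃ m, m = ∫ x, T x ∂PX := ⟨_, rfl⟩
  obtain ⟨Vr, hVr⟩ : ∃ Vr, Vr = ∫ x, (m - T x) ^ 2 ∂PX := ⟨_, rfl⟩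
  have hT0 : ∀ x, 0 ≤ T x := fun x => by simp only [T]; positivity
  have hm0 : 0 ≤ m := by rw [hm]; exact integral_nonneg hT0
  have hV0 : 0 ≤ Vr := by rw [hVr]; exact integral_nonneg fun x => sq_nonneg _
  obtain ⟨E1, E2, E3⟩ := aux_prod PX σ hσ a T ham hTm M (2 * R / σ ^ 2)
    (fun x => by simp only [a, T]; field_simp)
    (fun x => by
      simp only [a]
      rw [abs_div, abs_neg, abs_of_pos (by positivity : 0 < σ ^ 2)]
      gcongr; exact hD x) hT0
    (fun x => by
      simp only [T, M]
      have : (g₁ x - g₂ x) ^ 2 ≤ (2 * R) ^ 2 := by rw [← sq_abs]; gcongr; exact hD x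
      rw [div_le_div_iff₀ (by positivity) (by positivity)]
      nlinarith [sq_nonneg σ]) m Vr hm hVr
  have tr : ∀ F : ℝ → ℝ, Measurable F → ∫ z, F (gllr σ g₁ g₂ z) ∂P₁ =
      ∫ q, F (a q.1 * q.2 - T q.1) ∂(PX.prod (gaussianReal 0 (Real.toNNReal (σ ^ 2)))) := by
    intro F hF
    rw [hP₁, gaussRegMeasure, integral_map (by fun_prop)
      (Measurable.aestronglyMeasurable (by fun_prop))]
    congr 1
    ext q
    rw [llr_shift σ hσ]
  have I1 : ∫ z, gllr σ g₁ g₂ z ∂P₁ = -m := (tr (fun t => t) measurable_id).trans E1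
  have I1' : ∫ z, Real.log ((P₂.rnDeriv P₁ z).toReal) ∂P₁ = -m := (integral_congr_ae L21).trans I1
  have hVar : 2 * m + Vr ≤ ε ^ 2 := by
    rw [variance_congr L12, variance_eq_integral (by fun_prop), integral_neg, I1] at hV2
    have := (tr (fun t => (t + m) ^ 2) (by fun_prop)).trans E2
    rw [← this]
    refine le_trans (le_of_eq ?_) hV2
    congr 1
    ext z
    ring
  obtain ⟨c, hc⟩ : ∃ c, c = max (2 * R / σ) (4 * R ^ 2 / (3 * σ ^ 2)) := ⟨_, rfl⟩
  have hc1 : 2 * R / σ ≤ c := by rw [hc]; exact le_max_left _ _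
  have hc2 : 4 * R ^ 2 / (3 * σ ^ 2) ≤ c := by rw [hc]; exact le_max_right _ _
  have hc0 : 0 < c := lt_of_lt_of_le (by positivity) hc1
  have main : ∀ τ : ℝ, (τ = 1 ∨ τ = -1) → ∀ l : ℝ, 0 ≤ l → l < 1 / c →
      ∫ z, Real.exp (l * (τ * (Real.log ((P₂.rnDeriv P₁ z).toReal)
        - ∫ z', Real.log ((P₂.rnDeriv P₁ z').toReal) ∂P₁))) ∂P₁ ≤
      Real.exp (max 8 (2 / σ ^ 2) * ε ^ 2 * l ^ 2 / (2 * (1 - c * l))) := by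
    intro τ hτ l hl0 hl1
    have hcl : c * l < 1 := by
      rw [lt_div_iff₀ hc0] at hl1; linarith
    have hcl0 : 0 ≤ c * l := by positivity
    have b1 : l * M ≤ 3 / 2 := by
      have : l * M = 3 / 2 * ((4 * R ^ 2 / (3 * σ ^ 2)) * l) := by simp only [M]; field_simp; ring
      rw [this]
      have : (4 * R ^ 2 / (3 * σ ^ 2)) * l ≤ c * l := by gcongr
      linarith
    have b2 : l ^ 2 * M ≤ 1 / 2 := by
      have : l ^ 2 * M = 1 / 2 * ((2 * R / σ) * l) ^ 2 := by simp only [M]; field_simp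
      rw [this]
      have h1 : (2 * R / σ) * l ≤ c * l := by gcongr
      have h2 : 0 ≤ (2 * R / σ) * l := by positivity
      nlinarith
    have key := E3 l τ hl0 hτ b1 b2
    have := tr (fun t => Real.exp (l * (τ * (t + m)))) (by fun_prop)
    rw [← this] at key
    have e : ∫ z, Real.exp (l * (τ * (Real.log ((P₂.rnDeriv P₁ z).toReal)
        - ∫ z', Real.log ((P₂.rnDeriv P₁ z').toReal) ∂P₁))) ∂P₁ =
        ∫ z, Real.exp (l * (τ * (gllr σ g₁ g₂ z + m))) ∂P₁ := by
      rw [I1']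
      refine integral_congr_ae ?_
      filter_upwards [L21] with z hz
      rw [hz, sub_neg_eq_add]
    rw [e]
    refine key.trans (Real.exp_le_exp.2 ?_)
    rw [le_div_iff₀ (by linarith)]
    have h8 : 8 * ε ^ 2 ≤ max 8 (2 / σ ^ 2) * ε ^ 2 := by gcongr; exact le_max_left _ _
    have h9 : l ^ 2 * (3 * m + 4 * Vr) * (2 * (1 - c * l)) ≤ l ^ 2 * (3 * m + 4 * Vr) * 2 := by
      have : 0 ≤ l ^ 2 * (3 * m + 4 * Vr) := by positivity
      gcongr
      linarith
    refine h9.trans ?_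
    have h10 : (3 * m + 4 * Vr) * 2 ≤ max 8 (2 / σ ^ 2) * ε ^ 2 := by linarith
    calc l ^ 2 * (3 * m + 4 * Vr) * 2 = ((3 * m + 4 * Vr) * 2) * l ^ 2 := by ring
      _ ≤ _ := by gcongr
  rw [← hc]
  constructor
  · intro l h0 h1
    have := main 1 (Or.inl rfl) l h0 h1
    simpa only [one_mul] using this
  · intro l h0 h1
    have := main (-1) (Or.inr rfl) l h0 h1
    simpa only [neg_mul, one_mul] using this
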